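/- With notation of the generalized Lemma (fractional integrals with respect to an increasing function h): if |f'∘h| is convex on [a,b] (in the sense that |f'(h(t))| ≤ ((h(b)-h(t))/(h(b)-h(a)))|f'(h(a))| + ((h(t)-h(a))/(h(b)-h(a)))|f'(h(b))| for t ∈ [a,b]) and g is continuous, then |f(h((a+b)/2))[J_{((a+b)/2)-,h}^α g(h(a)) + J_{((a+b)/2)+,h}^α g(h(b))] − [J_{((a+b)/2)-,h}^α (g·(f∘h))(a) + J_{((a+b)/2)+,h}^α (g·(f∘h))(b)]| ≤ (‖g‖_{∞,[a,(a+b)/2]}/((h(b)-h(a))Γ(α+1))) { |f'(h(a))| [ (h((a+b)/2)-h(a))^{α+1}(h(b)-h(a))/(α+1) − (h((a+b)/2)-h(a))^{α+2}/(α+2) ] + |f'(h(b))| (h((a+b)/2)-h(a))^{α+2}/(α+2) } + (‖g‖_{∞,[(a+b)/2,b]}/((h(b)-h(a))Γ(α+1))) { |f'(h(b))| [ (h(b)-h((a+b)/2))^{α+1}(h(b)-h(a))/(α+1) − (h(b)-h((a+b)/2))^{α+2}/(α+2) ] + |f'(h(a))| (h(b)-h((a+b)/2))^{α+2}/(α+2)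 }. -/

import Mathlib

/-- The derivative of the primitive of `s ↦ s ^ (α - 1) * (K - (c * s + d * s ^ 2 / 2))`. -/
theorem hasDerivAt_rpow_quadratic_primitive {α s : ℝ} (hα : 0 < α) (hs : 0 < s) (K c d : ℝ) :
    HasDerivAt (fun x : ℝ => K * (x ^ α / α) - c * (x ^ (α + 1) / (α + 1)) -
      d / 2 * (x ^ (α + 2) / (α + 2)))
      (s ^ (α - 1) * (K - (c * s + d * s ^ 2 / 2))) s := by
  have h0 := Real.hasDerivAt_rpow_const (x := s) (p := α) (Or.inl hs.ne')
  have h1 := Real.hasDerivAt_rpow_const (x := s) (p := α + 1) (Or.inl hs.ne')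
  have h2 := Real.hasDerivAt_rpow_const (x := s) (p := α + 2) (Or.inl hs.ne')
  convert! (((h0.div_const α).const_mul K).sub ((h1.div_const (α + 1)).const_mul c)).sub
    ((h2.div_const (α + 2)).const_mul (d / 2)) using 1
  have e1 : s ^ (α + 1 - 1) = s ^ (α - 1) * s := by
    rw [← Real.rpow_add_one hs.ne']
    ring_nf
  have e2 : s ^ (α + 2 - 1) = s ^ (α - 1) * s ^ 2 := by
    rw [← Real.rpow_add_natCast hs.ne' (α - 1) 2]
    congr 1
    push_cast
    ring
  rw [e1, e2]
  have : α + 1 ≠ 0 := by positivity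
  have : α + 2 ≠ 0 := by positivity
  field_simp
  ring

/-- If `u` is monotone with derivative `v` on the interior, then `v` is integrable and its integral
is at most the increment of `u`; no continuity at the endpoints is needed. -/
theorem integrableOn_and_setIntegral_le_of_monotoneOn {u v : ℝ → ℝ} {a m : ℝ} (ham : a ≤ m)
    (hu : MonotoneOn u (Set.Icc a m)) (hd : ∀ t ∈ Set.Ioo a m, HasDerivAt u (v t) t) :
    MeasureTheory.IntegrableOn v (Set.Ioo a m) ∧ ∫ t in Set.Ioo a m, v t ≤ u m - u a := by
  rw [← Set.uIcc_of_le ham] at hu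
  have hle : u a ≤ u m := hu Set.left_mem_uIcc Set.right_mem_uIcc ham
  have h1 := hu.intervalIntegrable_deriv
  have h2 := hu.intervalIntegral_deriv_mem_uIcc
  rw [intervalIntegrable_iff_integrableOn_Ioo_of_le ham] at h1
  rw [intervalIntegral.integral_of_le ham, MeasureTheory.integral_Ioc_eq_integral_Ioo,
    Set.uIcc_of_le (sub_nonneg.2 hle)] at h2
  have hdv : Set.EqOn (deriv u) v (Set.Ioo a m) := fun t ht => (hd t ht).deriv
  rw [MeasureTheory.setIntegral_congr_fun measurableSet_Ioo hdv] at h2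
  exact ⟨h1.congr_fun hdv measurableSet_Ioo, h2.2⟩

/-- One-sided estimate: the weighted deviation of `f ∘ h` from its value at `m`, on `[a, m]`. -/
theorem abs_weighted_integral_sub_le (f f' g h h' : ℝ → ℝ) (a m b α : ℝ)
    (hm : m ∈ Set.Ioo a b) (hα : 0 < α)
    (hh_mono : StrictMonoOn h (Set.Icc a b))
    (hh : ∀ x ∈ Set.Ioo a b, HasDerivAt h (h' x) x)
    (hh' : ContinuousOn h' (Set.Ioo a b))
    (hf : ∀ x ∈ Set.Ioo (h a) (h b), HasDerivAt f (f' x) x)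
    (hg : ContinuousOn g (Set.Icc a b))
    (hconv : ∀ t ∈ Set.Icc a b,
      |f' (h t)| ≤ ((h b - h t) / (h b - h a)) * |f' (h a)| +
        ((h t - h a) / (h b - h a)) * |f' (h b)|) :
    |f (h m) * (∫ t in a..m, (h t - h a) ^ (α - 1) * h' t * g t) -
        ∫ t in a..m, (h t - h a) ^ (α - 1) * h' t * (g t * f (h t))| ≤
      (sSup ((fun x => |g x|) '' Set.Icc a m) / ((h b - h a) * α)) *
      (|f' (h a)| * ((h m - h a) ^ (α + 1) / (α + 1) * (h b - h a) -
            (h m - h a) ^ (α + 2) / (α + 2)) +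
        |f' (h b)| * ((h m - h a) ^ (α + 2) / (α + 2))) := by
  obtain ⟨ham, hmb⟩ := hm
  have hab : a < b := ham.trans hmb
  have ha_mem : a ∈ Set.Icc a b := ⟨le_rfl, hab.le⟩
  have hb_mem : b ∈ Set.Icc a b := ⟨hab.le, le_rfl⟩
  have hAB : 0 < h b - h a := sub_pos.2 (hh_mono ha_mem hb_mem hab)
  have hS : 0 < h m - h a := sub_pos.2 (hh_mono ha_mem ⟨ham.le, hmb.le⟩ ham)
  have hk_pos : ∀ t ∈ Set.Ioo a b, 0 < h t - h a := fun t ht =>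
    sub_pos.2 (hh_mono ha_mem ⟨ht.1.le, ht.2.le⟩ ht.1)
  have hk_lt : ∀ t ∈ Set.Ioo a b, h t < h b := fun t ht =>
    hh_mono ⟨ht.1.le, ht.2.le⟩ hb_mem ht.2
  have hh'_nonneg : ∀ t ∈ Set.Ioo a b, 0 ≤ h' t := by
    intro t ht
    rw [← (hh t ht).deriv, ← derivWithin_of_mem_nhds (Icc_mem_nhds ht.1 ht.2)]
    exact hh_mono.monotoneOn.derivWithin_nonneg
  have hsub : Set.Ioo a m ⊆ Set.Ioo a b := Set.Ioo_subset_Ioo_right hmb.le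
  set c : ℝ := |f' (h a)| with hc
  set d : ℝ := (|f' (h b)| - |f' (h a)|) / (h b - h a) with hd
  have hf'_le : ∀ t ∈ Set.Ioo a b, |f' (h t)| ≤ c + d * (h t - h a) := by
    intro t ht
    refine (hconv t ⟨ht.1.le, ht.2.le⟩).trans_eq ?_
    rw [hd, hc]
    field_simp
    ring
  set P : ℝ → ℝ := fun s => c * s + d * s ^ 2 / 2 with hP
  have hP_deriv : ∀ s, HasDerivAt P (c + d * s) s := by
    intro s
    convert! ((hasDerivAt_id s).const_mul c).add
      ((((hasDerivAt_id s).pow 2).const_mul d).div_const 2) using 1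
    simp
    ring
  have hPk : ∀ t ∈ Set.Ioo a b,
      HasDerivAt (fun x => P (h x - h a)) ((c + d * (h t - h a)) * h' t) t := fun t ht =>
    (hP_deriv _).comp t ((hh t ht).sub_const _)
  have hfh : ∀ t ∈ Set.Ioo a b, HasDerivAt (fun x => f (h x)) (f' (h t) * h' t) t := fun t ht =>
    (hf _ ⟨sub_pos.1 (hk_pos t ht), hk_lt t ht⟩).comp t (hh t ht)
  have hfh_cont : ContinuousOn (fun x => f (h x)) (Set.Ioo a b) := fun t ht =>
    (hfh t ht).continuousAt.continuousWithinAt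
  have hmono : ∀ u v : ℝ → ℝ, (∀ t ∈ Set.Ioo a b, HasDerivAt u (v t) t) →
      (∀ t ∈ Set.Ioo a b, 0 ≤ v t) → MonotoneOn u (Set.Ioo a b) := by
    intro u v hu hv
    refine monotoneOn_of_deriv_nonneg (convex_Ioo a b)
      (fun t ht => (hu t ht).continuousAt.continuousWithinAt) ?_ ?_
    · rw [interior_Ioo]
      exact fun t ht => (hu t ht).differentiableAt.differentiableWithinAt
    · rw [interior_Ioo]
      intro t ht
      rw [(hu t ht).deriv]
      exact hv t ht
  have hF_le : ∀ t ∈ Set.Ioo a m, |f (h m) - f (h t)| ≤ P (h m - h a) - P (h t - h a) := by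
    intro t ht
    have m1 := hmono _ _ (fun t ht => (hPk t ht).add (hfh t ht)) (fun t ht => by
      have := neg_le_of_abs_le (hf'_le t ht)
      have := mul_le_mul_of_nonneg_right this (hh'_nonneg t ht)
      linarith) (hsub ht) ⟨ham, hmb⟩ ht.2.le
    have m2 := hmono _ _ (fun t ht => (hPk t ht).sub (hfh t ht)) (fun t ht => by
      have := le_of_abs_le (hf'_le t ht)
      have := mul_le_mul_of_nonneg_right this (hh'_nonneg t ht)
      linarith) (hsub ht) ⟨ham, hmb⟩ ht.2.le
    simp only [Pi.add_apply, Pi.sub_apply] at m1 m2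
    rw [abs_le]
    constructor <;> linarith
  have hP_mono : ∀ s ∈ Set.Ioo 0 (h m - h a), P s ≤ P (h m - h a) := by
    have hnn : ∀ s ∈ Set.Ioo 0 (h m - h a), 0 ≤ c + d * s := by
      intro s hs
      have hsB : s ≤ h b - h a := hs.2.le.trans (by linarith [hk_lt m ⟨ham, hmb⟩])
      have : c + d * s = ((h b - h a - s) * |f' (h a)| + s * |f' (h b)|) / (h b - h a) := by
        rw [hd, hc]
        field_simp
        ring
      rw [this]
      have := sub_nonneg.2 hsB
      have := hs.1.le
      positivity
    have hmP : MonotoneOn P (Set.Icc 0 (h m - h a)) := by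
      refine monotoneOn_of_deriv_nonneg (convex_Icc _ _)
        (fun s _ => (hP_deriv s).continuousAt.continuousWithinAt)
        (fun s _ => (hP_deriv s).differentiableAt.differentiableWithinAt) ?_
      rw [interior_Icc]
      intro s hs
      rw [(hP_deriv s).deriv]
      exact hnn s hs
    exact fun s hs => hmP ⟨hs.1.le, hs.2.le⟩ ⟨hS.le, le_rfl⟩ hs.2.le
  set Φ : ℝ → ℝ := fun x => P (h m - h a) * (x ^ α / α) - c * (x ^ (α + 1) / (α + 1)) -
      d / 2 * (x ^ (α + 2) / (α + 2)) with hΦ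
  have hΦ_deriv : ∀ s, 0 < s → HasDerivAt Φ (s ^ (α - 1) * (P (h m - h a) - P s)) s := fun s hs =>
    hasDerivAt_rpow_quadratic_primitive hα hs _ _ _
  have hΦ_mono : MonotoneOn Φ (Set.Icc 0 (h m - h a)) := by
    have hcont : ∀ p : ℝ, 0 ≤ p → Continuous fun x : ℝ => x ^ p := fun p hp =>
      Real.continuous_rpow_const hp
    refine monotoneOn_of_deriv_nonneg (convex_Icc _ _) ?_ ?_ ?_
    · have h0 := hcont α hα.le
      have h1 := hcont (α + 1) (by positivity)
      have h2 := hcont (α + 2) (by positivity)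
      exact Continuous.continuousOn (by fun_prop)
    · rw [interior_Icc]
      exact fun s hs => (hΦ_deriv s hs.1).differentiableAt.differentiableWithinAt
    · rw [interior_Icc]
      intro s hs
      rw [(hΦ_deriv s hs.1).deriv]
      exact mul_nonneg (Real.rpow_nonneg hs.1.le _) (sub_nonneg.2 (hP_mono s hs))
  have hk_maps : ∀ t ∈ Set.Icc a m, h t - h a ∈ Set.Icc 0 (h m - h a) := by
    intro t ht
    have ht' : t ∈ Set.Icc a b := ⟨ht.1, ht.2.trans hmb.le⟩
    exact ⟨sub_nonneg.2 (hh_mono.monotoneOn ha_mem ht' ht.1),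
      sub_le_sub_right (hh_mono.monotoneOn ht' ⟨ham.le, hmb.le⟩ ht.2) _⟩
  have hk_mono : MonotoneOn (fun t => h t - h a) (Set.Icc a m) := fun s hs t ht hst =>
    sub_le_sub_right (hh_mono.monotoneOn ⟨hs.1, hs.2.trans hmb.le⟩ ⟨ht.1, ht.2.trans hmb.le⟩ hst) _
  set w : ℝ → ℝ := fun t => (h t - h a) ^ (α - 1) * h' t with hw
  have hw_nonneg : ∀ t ∈ Set.Ioo a m, 0 ≤ w t := fun t ht =>
    mul_nonneg (Real.rpow_nonneg (hk_pos t (hsub ht)).le _) (hh'_nonneg t (hsub ht))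
  have hw_int : MeasureTheory.IntegrableOn w (Set.Ioo a m) := by
    have := (integrableOn_and_setIntegral_le_of_monotoneOn (u := fun t => (h t - h a) ^ α / α)
      (v := w) ham.le ?_ ?_).1
    · exact this
    · intro s hs t ht hst
      have := Real.rpow_le_rpow (hk_maps s hs).1 (hk_mono hs ht hst) hα.le
      exact div_le_div_of_nonneg_right this hα.le
    · intro t ht
      have := (((hh t (hsub ht)).sub_const (h a)).rpow_const (p := α)
        (Or.inl (hk_pos t (hsub ht)).ne')).div_const α
      convert! this using 1
      simp only [hw]
      field_simp
  obtain ⟨hM_int, hM_le⟩ := integrableOn_and_setIntegral_le_of_monotoneOn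
    (u := fun t => Φ (h t - h a)) (v := fun t => w t * (P (h m - h a) - P (h t - h a))) ham.le
    (fun s hs t ht hst => hΦ_mono (hk_maps s hs) (hk_maps t ht) (hk_mono hs ht hst))
    (fun t ht => by
      convert! (hΦ_deriv _ (hk_pos t (hsub ht))).comp t ((hh t (hsub ht)).sub_const (h a)) using 1
      simp only [hw]
      ring)
  set G := sSup ((fun x => |g x|) '' Set.Icc a m) with hG
  have hg_le : ∀ t ∈ Set.Icc a m, |g t| ≤ G := fun t ht =>
    le_csSup (isCompact_Icc.bddAbove_image (hg.mono (Set.Icc_subset_Icc_right hmb.le)).abs)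
      (Set.mem_image_of_mem _ ht)
  have hG_nonneg : 0 ≤ G := (abs_nonneg _).trans (hg_le a ⟨le_rfl, ham.le⟩)
  have hg_cont : ContinuousOn g (Set.Ioo a m) :=
    hg.mono (hsub.trans Set.Ioo_subset_Icc_self)
  have hw_cont : ContinuousOn w (Set.Ioo a m) := by
    refine ContinuousOn.mul (fun t ht => ?_) (hh'.mono hsub)
    exact (((hh t (hsub ht)).continuousAt.sub continuousAt_const).rpow_const
      (Or.inl (hk_pos t (hsub ht)).ne')).continuousWithinAt
  have hF_cont : ContinuousOn (fun t => f (h m) - f (h t)) (Set.Ioo a m) :=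
    continuousOn_const.sub (hfh_cont.mono hsub)
  have hwg_int : MeasureTheory.IntegrableOn (fun t => w t * g t) (Set.Ioo a m) := by
    refine MeasureTheory.Integrable.mono' (hw_int.const_mul G)
      ((hw_cont.mul hg_cont).aestronglyMeasurable measurableSet_Ioo) ?_
    refine (MeasureTheory.ae_restrict_iff' measurableSet_Ioo).2 (.of_forall fun t ht => ?_)
    rw [Real.norm_eq_abs, abs_mul, abs_of_nonneg (hw_nonneg t ht), mul_comm]
    exact mul_le_mul_of_nonneg_right (hg_le t (Set.Ioo_subset_Icc_self ht)) (hw_nonneg t ht)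
  have hbound : ∀ t ∈ Set.Ioo a m, ‖w t * g t * (f (h m) - f (h t))‖ ≤
      G * (w t * (P (h m - h a) - P (h t - h a))) := by
    intro t ht
    rw [Real.norm_eq_abs, abs_mul, abs_mul, abs_of_nonneg (hw_nonneg t ht), mul_comm (w t),
      mul_assoc]
    exact mul_le_mul (hg_le t (Set.Ioo_subset_Icc_self ht))
      (mul_le_mul_of_nonneg_left (hF_le t ht) (hw_nonneg t ht))
      (mul_nonneg (hw_nonneg t ht) (abs_nonneg _)) hG_nonneg
  have hbound_ae := (MeasureTheory.ae_restrict_iff' (μ := MeasureTheory.volume)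
    measurableSet_Ioo).2 (.of_forall hbound)
  have hD_int : MeasureTheory.IntegrableOn (fun t => w t * g t * (f (h m) - f (h t)))
      (Set.Ioo a m) :=
    MeasureTheory.Integrable.mono' (hM_int.const_mul G)
      (((hw_cont.mul hg_cont).mul hF_cont).aestronglyMeasurable measurableSet_Ioo) hbound_ae
  have hwgf_int : MeasureTheory.IntegrableOn (fun t => w t * (g t * f (h t))) (Set.Ioo a m) := by
    refine ((hwg_int.const_mul (f (h m))).sub hD_int).congr (.of_forall fun t => ?_)
    simp only [Pi.sub_apply]
    ring
  have hdiff : f (h m) * (∫ t in a..m, w t * g t) - ∫ t in a..m, w t * (g t * f (h t)) =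
      ∫ t in Set.Ioo a m, w t * g t * (f (h m) - f (h t)) := by
    rw [intervalIntegral.integral_of_le ham.le, intervalIntegral.integral_of_le ham.le,
      MeasureTheory.integral_Ioc_eq_integral_Ioo, MeasureTheory.integral_Ioc_eq_integral_Ioo,
      ← MeasureTheory.integral_const_mul,
      ← MeasureTheory.integral_sub (hwg_int.const_mul _) hwgf_int]
    congr 1
    ext t
    ring
  rw [hdiff, ← Real.norm_eq_abs]
  refine (MeasureTheory.norm_integral_le_of_norm_le (hM_int.const_mul G) hbound_ae).trans ?_
  rw [MeasureTheory.integral_const_mul]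
  refine (mul_le_mul_of_nonneg_left hM_le hG_nonneg).trans_eq ?_
  have e1 : (h m - h a) ^ (α + 1) = (h m - h a) ^ α * (h m - h a) := Real.rpow_add_one hS.ne' _
  have e2 : (h m - h a) ^ (α + 2) = (h m - h a) ^ α * (h m - h a) ^ 2 := by
    exact_mod_cast Real.rpow_add_natCast hS.ne' α 2
  have z : ∀ p : ℝ, 0 < p → (0 : ℝ) ^ p = 0 := fun p hp => Real.zero_rpow hp.ne'
  simp only [hΦ, hP, sub_self, z α hα, z (α + 1) (by positivity), z (α + 2) (by positivity),
    e1, e2, hd, ← hc]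
  generalize (h m - h a) ^ α = X
  have : α + 1 ≠ 0 := by positivity
  have : α + 2 ≠ 0 := by positivity
  field_simp
  ring


theorem fejer_fractional_bound_wrt_h
    (f f' g h h' : ℝ → ℝ) (a b α : ℝ) (hab : a < b) (hα : 0 < α)
    (hh_mono : StrictMonoOn h (Set.Icc a b))
    (hh : ∀ x ∈ Set.Ioo a b, HasDerivAt h (h' x) x)
    (hh' : ContinuousOn h' (Set.Ioo a b))
    (hf : ∀ x ∈ Set.Ioo (h a) (h b), HasDerivAt f (f' x) x)
    (hg : ContinuousOn g (Set.Icc a b))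
    (hconv : ∀ t ∈ Set.Icc a b,
      |f' (h t)| ≤ ((h b - h t) / (h b - h a)) * |f' (h a)| +
        ((h t - h a) / (h b - h a)) * |f' (h b)|) :
    |f (h ((a + b) / 2)) *
        ((1 / Real.Gamma α) * (∫ t in a..(a + b) / 2, (h t - h a) ^ (α - 1) * h' t * g t) +
          (1 / Real.Gamma α) * ∫ t in ((a + b) / 2)..b, (h b - h t) ^ (α - 1) * h' t * g t) -
      ((1 / Real.Gamma α) *
          (∫ t in a..(a + b) / 2, (h t - h a) ^ (α - 1) * h' t * (g t * f (h t))) +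
        (1 / Real.Gamma α) *
          ∫ t in ((a + b) / 2)..b, (h b - h t) ^ (α - 1) * h' t * (g t * f (h t)))| ≤
    (sSup ((fun x => |g x|) '' Set.Icc a ((a + b) / 2)) /
        ((h b - h a) * Real.Gamma (α + 1))) *
      (|f' (h a)| *
          ((h ((a + b) / 2) - h a) ^ (α + 1) / (α + 1) * (h b - h a) -
            (h ((a + b) / 2) - h a) ^ (α + 2) / (α + 2)) +
        |f' (h b)| * ((h ((a + b) / 2) - h a) ^ (α + 2) / (α + 2))) +
    (sSup ((fun x => |g x|) '' Set.Icc ((a + b) / 2) b) /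
        ((h b - h a) * Real.Gamma (α + 1))) *
      (|f' (h b)| *
          ((h b - h ((a + b) / 2)) ^ (α + 1) / (α + 1) * (h b - h a) -
            (h b - h ((a + b) / 2)) ^ (α + 2) / (α + 2)) +
        |f' (h a)| * ((h b - h ((a + b) / 2)) ^ (α + 2) / (α + 2))) := by
  set m := (a + b) / 2 with hm
  have hmem : m ∈ Set.Ioo a b := ⟨by rw [hm]; linarith, by rw [hm]; linarith⟩
  have left := abs_weighted_integral_sub_le f f' g h h' a m b α hmem hα hh_mono hh hh' hf hg hconv
  have right := abs_weighted_integral_sub_le (fun x => f (-x)) (fun x => -f' (-x))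
    (fun x => g (-x)) (fun x => -h (-x)) (fun x => h' (-x)) (-b) (-m) (-a) α
    ⟨neg_lt_neg hmem.2, neg_lt_neg hmem.1⟩ hα
    (fun x hx y hy hxy => neg_lt_neg (hh_mono ⟨le_neg.1 hy.2, neg_le.1 hy.1⟩
      ⟨le_neg.1 hx.2, neg_le.1 hx.1⟩ (neg_lt_neg hxy)))
    (fun x hx => by
      have := hh (-x) ⟨lt_neg.1 hx.2, neg_lt.1 hx.1⟩
      convert! (this.comp x (hasDerivAt_neg x)).neg using 1
      ring)
    (hh'.comp continuousOn_neg fun x hx => ⟨lt_neg.1 hx.2, neg_lt.1 hx.1⟩)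
    (fun x hx => by
      simp only [neg_neg] at hx
      convert! (hf (-x) ⟨lt_neg.1 hx.2, neg_lt.1 hx.1⟩).comp x (hasDerivAt_neg x) using 1
      ring)
    (hg.comp continuousOn_neg fun x hx => ⟨le_neg.1 hx.2, neg_le.1 hx.1⟩)
    (fun t ht => by
      have := hconv (-t) ⟨le_neg.1 ht.2, neg_le.1 ht.1⟩
      simp only [neg_neg, abs_neg, neg_sub_neg]
      linarith)
  have hsup : (fun x => |g (-x)|) '' Set.Icc (-b) (-m) = (fun x => |g x|) '' Set.Icc m b := by
    rw [← Set.image_neg_Icc, Set.image_image]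
    simp
  have i1 := intervalIntegral.integral_comp_neg (a := -b) (b := -m)
    (fun t => (h b - h t) ^ (α - 1) * h' t * g t)
  have i2 := intervalIntegral.integral_comp_neg (a := -b) (b := -m)
    (fun t => (h b - h t) ^ (α - 1) * h' t * (g t * f (h t)))
  simp only [neg_neg] at i1 i2
  simp only [neg_neg, abs_neg, neg_sub_neg, hsup, i1, i2] at right
  have hΓ : 0 < Real.Gamma α := Real.Gamma_pos_of_pos hα
  rw [Real.Gamma_add_one hα.ne']
  have key := mul_le_mul_of_nonneg_left ((abs_add_le _ _).trans (add_le_add left right))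
    (one_div_nonneg.2 hΓ.le)
  rw [← abs_of_nonneg (one_div_nonneg.2 hΓ.le), ← abs_mul,
    abs_of_nonneg (one_div_nonneg.2 hΓ.le)] at key
  have hAB : h b - h a ≠ 0 :=
    (sub_pos.2 (hh_mono ⟨le_rfl, hab.le⟩ ⟨hab.le, le_rfl⟩ hab)).ne'
  refine Eq.trans_le ?_ (key.trans_eq ?_)
  · refine congrArg abs ?_
    ring
  · field_simp
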